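/- Browder fixed point via minimax: let X be a nonempty compact convex subset of ℝⁿ and h : X → X continuous. Applying the pseudo-continuous minimax inequality to f(x,y) = -‖h(x) - y‖ yields a fixed point: there exists x₀ ∈ X with h(x₀) = x₀. -/

import Mathlib

/-- A set `S` of points is dominating for the family of rankings `v` if no point is ranked strictly
above the lowest point of `S` by all members of the family. -/
def Dominating {ι P L : Type*} [LinearOrder L] (v : ι → P → L) (S : Finset P) : Prop :=
  ∀ x, ∃ i, ∀ y ∈ S, v i x ≤ v i y

/-- The point `x` is best in the ranking `j` among those placed strictly above the mark `m i` by
every ranking `i ≠ j`. -/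
def IsBestAbove {ι P L : Type*} [LinearOrder L] (v : ι → P → L) (m : ι → P) (j : ι) (x : P) :
    Prop :=
  (∀ i, i ≠ j → v i (m i) < v i x) ∧ ∀ z, (∀ i, i ≠ j → v i (m i) < v i z) → v j z ≤ v j x

section Scarf

variable {ι P L : Type*} [LinearOrder L]
  {v : ι → P → L} {τ : Finset P} {m : ι → P}

theorem exists_isBestAbove [Finite P] {j : ι} {w : P} (hw : ∀ i, i ≠ j → v i (m i) < v i w) :
    ∃ x, IsBestAbove v m j x := by
  classical
  have := Fintype.ofFinite P
  obtain ⟨x, hx, hmax⟩ := Finset.exists_max_image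
    (Finset.univ.filter fun z => ∀ i, i ≠ j → v i (m i) < v i z) (v j) ⟨w, by simpa using hw⟩
  exact ⟨x, by simpa using hx, fun z hz => hmax z (by simpa using hz)⟩

theorem IsBestAbove.unique (hv : ∀ i, Function.Injective (v i)) {j : ι} {x y : P}
    (hx : IsBestAbove v m j x) (hy : IsBestAbove v m j y) : x = y :=
  hv j (le_antisymm (hy.2 x hx.1) (hx.2 y hy.1))

theorem Dominating.insert_of_isBestAbove [DecidableEq P] (hτ : Dominating v τ) (hm : ∀ i, m i ∈ τ)
    (hmin : ∀ i, ∀ y ∈ τ, v i (m i) ≤ v i y) {j : ι} {x : P} (hx : IsBestAbove v m j x) :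
    Dominating v (insert x τ) := by
  intro z
  by_cases hz : ∀ i, i ≠ j → v i (m i) < v i z
  · obtain ⟨k, hk⟩ := hτ z
    have hkj : k = j := by
      by_contra hkj
      exact absurd (hk _ (hm k)) (not_le.2 (hz k hkj))
    subst hkj
    refine ⟨k, fun y hy => ?_⟩
    rcases Finset.mem_insert.1 hy with rfl | hy
    · exact hx.2 z hz
    · exact hk y hy
  · push Not at hz
    obtain ⟨i, hij, hi⟩ := hz
    refine ⟨i, fun y hy => ?_⟩
    rcases Finset.mem_insert.1 hy with rfl | hy
    · exact hi.trans (hx.1 i hij).le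
    · exact hi.trans (hmin i y hy)

variable [Fintype ι] [DecidableEq P]

/-- In a dominating set with one point less than there are rankings, precisely two rankings share
their lowest point. -/
theorem Dominating.exists_pair [DecidableEq ι] (hv : ∀ i, Function.Injective (v i))
    (hτ : Dominating v τ)
    (hcard : τ.card + 1 = Fintype.card ι) (hm : ∀ i, m i ∈ τ)
    (hmin : ∀ i, ∀ y ∈ τ, v i (m i) ≤ v i y) :
    ∃ a b, a ≠ b ∧ m a = m b ∧ ∀ i j, i ≠ j → m i = m j → (i = a ∨ i = b) := by
  have hsurj : ∀ y ∈ τ, ∃ i, m i = y := fun y hy => by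
    obtain ⟨i, hi⟩ := hτ y
    exact ⟨i, hv i (le_antisymm (hmin i y hy) (hi _ (hm i)))⟩
  obtain ⟨a, -, b, -, hab, hmab⟩ := Finset.exists_ne_map_eq_of_card_lt_of_maps_to
    (s := Finset.univ) (t := τ) (f := m) (by rw [Finset.card_univ]; omega) (fun i _ => hm i)
  have key : ∀ a b, a ≠ b → m a = m b → Set.InjOn m (Finset.univ.erase a : Finset ι) := by
    intro a b hab hmab
    rw [← Finset.card_image_iff]
    have : (Finset.univ.erase a).image m = τ := by
      ext y
      simp only [Finset.mem_image, Finset.mem_erase, Finset.mem_univ, and_true]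
      refine ⟨fun ⟨i, _, hi⟩ => hi ▸ hm i, fun hy => ?_⟩
      obtain ⟨i, rfl⟩ := hsurj y hy
      by_cases hi : i = a
      · exact ⟨b, hab.symm, by rw [hi, hmab]⟩
      · exact ⟨i, hi, rfl⟩
    rw [this, Finset.card_erase_of_mem (Finset.mem_univ _), Finset.card_univ]
    omega
  refine ⟨a, b, hab, hmab, fun i j hij hmij => ?_⟩
  by_contra! hne
  have h1 := key a b hab hmab
  have h2 := key b a hab.symm hmab.symm
  by_cases hja : j = a
  · exact hij (h2 (by simp [hne]) (by simpa [hja] using hab) hmij)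
  · exact hij (h1 (by simp [hne]) (by simp [hja]) hmij)

theorem Dominating.isBestAbove_of_insert [DecidableEq ι] (hv : ∀ i, Function.Injective (v i))
    (hcard : τ.card + 1 = Fintype.card ι) (hm : ∀ i, m i ∈ τ)
    (hmin : ∀ i, ∀ y ∈ τ, v i (m i) ≤ v i y) {x : P} (hxτ : x ∉ τ)
    (hx : Dominating v (insert x τ)) :
    ∃ j, (∃ k, k ≠ j ∧ m k = m j) ∧ IsBestAbove v m j x := by
  obtain ⟨j, hj⟩ := hx x
  have hcover : ∀ y ∈ τ, ∃ k, m k = y ∧ v k y < v k x := fun y hy => by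
    obtain ⟨k, hk⟩ := hx y
    refine ⟨k, hv k (le_antisymm (hmin k y hy) (hk _ (by simp [hm]))), ?_⟩
    refine lt_of_le_of_ne (hk x (by simp)) fun h => hxτ ?_
    rwa [← hv k h]
  have hlow : ∀ i, i ≠ j → v i (m i) < v i x := by
    intro i hij
    by_contra! hi
    have hsub : τ ⊆ ((Finset.univ.erase j).erase i).image m := by
      intro y hy
      obtain ⟨k, rfl, hk⟩ := hcover y hy
      refine Finset.mem_image.2 ⟨k, ?_, rfl⟩
      simp only [Finset.mem_erase, Finset.mem_univ, and_true]
      refine ⟨?_, ?_⟩ <;> rintro rfl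
      · exact absurd hk (not_lt.2 hi)
      · exact absurd hk (not_lt.2 (hj _ (by simp [hm])))
    have h1 := (Finset.card_le_card hsub).trans Finset.card_image_le
    rw [Finset.card_erase_of_mem (by simp [hij]), Finset.card_erase_of_mem (by simp),
      Finset.card_univ] at h1
    have : 1 < Fintype.card ι := Fintype.one_lt_card_iff.2 ⟨i, j, hij⟩
    omega
  refine ⟨j, ?_, hlow, fun z hz => ?_⟩
  · obtain ⟨k, hk, hlt⟩ := hcover (m j) (hm j)
    refine ⟨k, ?_, hk⟩
    rintro rfl
    exact absurd hlt (not_lt.2 (hj _ (by simp [hm])))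
  · obtain ⟨k, hk⟩ := hx z
    have hkj : k = j := by
      by_contra hkj
      exact absurd (hk (m k) (by simp [hm])) (not_le.2 (hz k hkj))
    subst hkj
    exact hk x (by simp)

/-- A description of the dominating one-point extensions of a dominating set. -/
theorem Dominating.exists_insert_iff [DecidableEq ι] (hv : ∀ i, Function.Injective (v i))
    (hτ : Dominating v τ)
    (hcard : τ.card + 1 = Fintype.card ι) (hm : ∀ i, m i ∈ τ)
    (hmin : ∀ i, ∀ y ∈ τ, v i (m i) ≤ v i y) :
    ∃ a b, a ≠ b ∧ m a = m b ∧ (∀ i j, i ≠ j → m i = m j → (i = a ∨ i = b)) ∧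
      (∀ x, (x ∉ τ ∧ Dominating v (insert x τ)) ↔ IsBestAbove v m a x ∨ IsBestAbove v m b x) ∧
      ∀ x, ¬ (IsBestAbove v m a x ∧ IsBestAbove v m b x) := by
  obtain ⟨a, b, hab, hmab, huniq⟩ := hτ.exists_pair hv hcard hm hmin
  have hnot : ∀ a b, a ≠ b → m a = m b → ∀ x, IsBestAbove v m a x → x ∉ τ := by
    intro a b hab hmab x hx hxτ
    obtain ⟨k, hk⟩ := hτ x
    have hkx : m k = x := hv k (le_antisymm (hmin k x hxτ) (hk _ (hm k)))
    by_cases hka : k = a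
    · have := hx.1 b hab.symm
      rw [← hmab, ← hka, hkx] at this
      exact lt_irrefl _ this
    · have := hx.1 k hka
      rw [hkx] at this
      exact lt_irrefl _ this
  refine ⟨a, b, hab, hmab, huniq, fun x => ⟨fun ⟨hxτ, hx⟩ => ?_, ?_⟩, fun x ⟨ha, hb⟩ => ?_⟩
  · obtain ⟨j, ⟨k, hkj, hmkj⟩, hj⟩ := Dominating.isBestAbove_of_insert hv hcard hm hmin hxτ hx
    rcases huniq j k hkj.symm hmkj.symm with rfl | rfl
    · exact .inl hj
    · exact .inr hj
  · rintro (hx | hx)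
    · exact ⟨hnot a b hab hmab x hx, hτ.insert_of_isBestAbove hm hmin hx⟩
    · exact ⟨hnot b a hab.symm hmab.symm x hx, hτ.insert_of_isBestAbove hm hmin hx⟩
  · obtain ⟨k, hk⟩ := hτ x
    by_cases hka : k = a
    · exact absurd (hk _ (hm k)) (not_le.2 (hb.1 k (by rw [hka]; exact hab)))
    · exact absurd (hk _ (hm k)) (not_le.2 (ha.1 k hka))

variable [Fintype P]

open scoped Classical in
/-- The dominating sets with as many points as there are rankings. -/
noncomputable def rooms (v : ι → P → L) : Finset (Finset P) :=
  Finset.univ.filter fun S => Dominating v S ∧ S.card = Fintype.card ι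

open scoped Classical in
/-- The dominating sets whose points carry each colour except `i₀` precisely once. -/
noncomputable def doors [DecidableEq ι] (v : ι → P → L) (c : P → ι) (i₀ : ι) : Finset (Finset P) :=
  Finset.univ.filter fun τ => Dominating v τ ∧ τ.card + 1 = Fintype.card ι ∧
    τ.image c = Finset.univ.erase i₀

theorem mem_rooms_of_subset_iff (hcard : τ.card + 1 = Fintype.card ι) (S : Finset P) :
    (S ∈ rooms v ∧ τ ⊆ S) ↔ ∃ x, (x ∉ τ ∧ Dominating v (insert x τ)) ∧ insert x τ = S := by
  simp only [rooms, Finset.mem_filter, Finset.mem_univ, true_and]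
  constructor
  · rintro ⟨⟨hS, hc⟩, hsub⟩
    obtain ⟨x, hx, rfl⟩ := Finset.exists_eq_insert_iff.2 ⟨hsub, hcard.trans hc.symm⟩
    exact ⟨x, ⟨hx, hS⟩, rfl⟩
  · rintro ⟨x, ⟨hx, hd⟩, rfl⟩
    exact ⟨⟨hd, by rw [Finset.card_insert_of_notMem hx, hcard]⟩, Finset.subset_insert _ _⟩

variable [DecidableEq ι]

theorem even_card_doors_of_room {c : P → ι} {i₀ : ι} {S : Finset P} (hS : S ∈ rooms v)
    (hc : S.image c ≠ Finset.univ) : Even ((doors v c i₀).filter (· ⊆ S)).card := by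
  simp only [rooms, Finset.mem_filter, Finset.mem_univ, true_and] at hS
  obtain ⟨hdom, hcard⟩ := hS
  rcases ((doors v c i₀).filter (· ⊆ S)).eq_empty_or_nonempty with he | ⟨τ, hτ⟩
  · simp [he]
  have hdoor : ∀ τ, τ ∈ (doors v c i₀).filter (· ⊆ S) ↔
      ∃ x ∈ S, τ = S.erase x ∧ (S.erase x).image c = Finset.univ.erase i₀ := by
    intro τ
    simp only [doors, Finset.mem_filter, Finset.mem_univ, true_and]
    constructor
    · rintro ⟨⟨-, h2, h3⟩, hsub⟩
      obtain ⟨x, hx, rfl⟩ := Finset.exists_eq_insert_iff.2 ⟨hsub, h2.trans hcard.symm⟩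
      exact ⟨x, by simp, by simp [hx], by simpa [hx] using h3⟩
    · rintro ⟨x, hx, rfl, h⟩
      refine ⟨⟨fun z => ?_, by rw [Finset.card_erase_add_one hx, hcard], h⟩, S.erase_subset x⟩
      obtain ⟨i, hi⟩ := hdom z
      exact ⟨i, fun y hy => hi y (Finset.mem_of_mem_erase hy)⟩
  have hinj : ∀ x ∈ S, (S.erase x).image c = Finset.univ.erase i₀ →
      Set.InjOn c (S.erase x : Finset P) := by
    intro x hx h
    rw [← Finset.card_image_iff, h, Finset.card_erase_of_mem hx,
      Finset.card_erase_of_mem (Finset.mem_univ _), hcard, Finset.card_univ]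
  obtain ⟨x, hx, rfl, himg⟩ := (hdoor τ).1 hτ
  have hcx : c x ≠ i₀ := by
    rintro rfl
    apply hc
    rw [← Finset.insert_erase hx, Finset.image_insert, himg, Finset.insert_erase (by simp)]
  obtain ⟨x', hx', hcx'⟩ := Finset.mem_image.1
    (show c x ∈ (S.erase x).image c by rw [himg]; simp [hcx])
  obtain ⟨hne, hx'S⟩ := Finset.mem_erase.1 hx'
  have himg' : (S.erase x').image c = Finset.univ.erase i₀ := by
    rw [← himg]
    apply Finset.Subset.antisymm
    · intro i hi
      obtain ⟨y, hy, rfl⟩ := Finset.mem_image.1 hi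
      by_cases hyx : y = x
      · exact Finset.mem_image.2 ⟨x', hx', by rw [hyx, hcx']⟩
      · exact Finset.mem_image_of_mem _
          (Finset.mem_erase.2 ⟨hyx, Finset.mem_of_mem_erase hy⟩)
    · intro i hi
      obtain ⟨y, hy, rfl⟩ := Finset.mem_image.1 hi
      by_cases hyx : y = x'
      · exact Finset.mem_image.2 ⟨x, Finset.mem_erase.2 ⟨hne.symm, hx⟩, by rw [hyx, hcx']⟩
      · exact Finset.mem_image_of_mem _
          (Finset.mem_erase.2 ⟨hyx, Finset.mem_of_mem_erase hy⟩)
  have : (doors v c i₀).filter (· ⊆ S) = {S.erase x, S.erase x'} := by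
    ext τ
    rw [hdoor, Finset.mem_insert, Finset.mem_singleton]
    constructor
    · rintro ⟨y, hy, rfl, h⟩
      by_contra! hcon
      have hyx : x ≠ y := by rintro rfl; exact hcon.1 rfl
      have hyx' : x' ≠ y := by rintro rfl; exact hcon.2 rfl
      exact hne (hinj y hy h (by simp [hyx', hx'S]) (by simp [hyx, hx]) hcx')
    · rintro (rfl | rfl)
      · exact ⟨x, hx, rfl, himg⟩
      · exact ⟨x', hx'S, rfl, himg'⟩
  rw [this, Finset.card_pair]
  · exact even_two
  · intro h
    have : x' ∈ S.erase x' := h ▸ hx'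
    simp at this

theorem even_card_rooms_of_door (hv : ∀ i, Function.Injective (v i)) {b : ι → P}
    (hb : ∀ i j, i ≠ j → ∀ x ∉ Set.range b, v i x < v i (b j)) (hτ : Dominating v τ)
    (hcard : τ.card + 1 = Fintype.card ι) {t : P} (ht : t ∈ τ) (htb : t ∉ Set.range b) :
    Even ((rooms v).filter (τ ⊆ ·)).card := by
  choose m hm hmin using fun i => Finset.exists_min_image τ (v i) ⟨t, ht⟩
  obtain ⟨p, q, -, -, -, hiff, hdisj⟩ := hτ.exists_insert_iff hv hcard hm hmin
  have hex : ∀ j, ∃ x, IsBestAbove v m j x := fun j =>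
    exists_isBestAbove (w := b j) fun i hij => (hmin i t ht).trans_lt (hb i j hij t htb)
  obtain ⟨x, hx⟩ := hex p
  obtain ⟨y, hy⟩ := hex q
  have hxτ := ((hiff x).2 (.inl hx)).1
  have : (rooms v).filter (τ ⊆ ·) = {insert x τ, insert y τ} := by
    ext S
    rw [Finset.mem_filter, mem_rooms_of_subset_iff hcard, Finset.mem_insert, Finset.mem_singleton]
    simp only [hiff]
    constructor
    · rintro ⟨z, hz | hz, rfl⟩
      · exact .inl (by rw [hz.unique hv hx])
      · exact .inr (by rw [hz.unique hv hy])
    · rintro (rfl | rfl)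
      · exact ⟨x, .inl hx, rfl⟩
      · exact ⟨y, .inr hy, rfl⟩
  rw [this, Finset.card_pair]
  · exact even_two
  · intro h
    have hxy : x ∈ insert y τ := h ▸ Finset.mem_insert_self x τ
    rcases Finset.mem_insert.1 hxy with rfl | hxy
    · exact hdisj x ⟨hx, hy⟩
    · exact hxτ hxy

theorem card_rooms_of_boundary_door [Nontrivial ι] (hv : ∀ i, Function.Injective (v i)) {b : ι → P}
    (hbinj : Function.Injective b) (hbmin : ∀ i x, v i (b i) ≤ v i x)
    (hb : ∀ i j, i ≠ j → ∀ x ∉ Set.range b, v i x < v i (b j)) {t : P} (htb : t ∉ Set.range b)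
    (i₀ : ι) (hτ : Dominating v ((Finset.univ.erase i₀).image b)) :
    ((rooms v).filter ((Finset.univ.erase i₀).image b ⊆ ·)).card = 1 := by
  have hcard : ((Finset.univ.erase i₀).image b).card + 1 = Fintype.card ι := by
    rw [Finset.card_image_of_injective _ hbinj, Finset.card_erase_add_one (Finset.mem_univ _),
      Finset.card_univ]
  set τ := (Finset.univ.erase i₀).image b with hτdef
  have hmem : ∀ i, i ≠ i₀ → b i ∈ τ := fun i hi => Finset.mem_image_of_mem _ (by simp [hi])
  obtain ⟨i₁, hi₁⟩ := exists_ne i₀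
  choose m hm hmin using fun i => Finset.exists_min_image τ (v i) ⟨b i₁, hmem i₁ hi₁⟩
  obtain ⟨p, q, -, -, huniq, hiff, -⟩ := hτ.exists_insert_iff hv hcard hm hmin
  have hmi : ∀ i, i ≠ i₀ → m i = b i := fun i hi =>
    hv i (le_antisymm (hmin i _ (hmem i hi)) (hbmin i _))
  obtain ⟨k, hk, hbk⟩ := Finset.mem_image.1 (hm i₀)
  have hk0 : k ≠ i₀ := (Finset.mem_erase.1 hk).1
  have hiff' : ∀ x, (x ∉ τ ∧ Dominating v (insert x τ)) ↔
      IsBestAbove v m i₀ x ∨ IsBestAbove v m k x := by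
    have h0 := huniq i₀ k hk0.symm (by rw [hmi k hk0, hbk])
    have h1 := huniq k i₀ hk0 (by rw [hmi k hk0, hbk])
    intro x
    rw [hiff]
    rcases h0 with rfl | rfl <;> rcases h1 with rfl | rfl <;> tauto
  have hnone : ∀ x, ¬ IsBestAbove v m k x := by
    intro x hx
    have hx0 := hx.1 i₀ hk0.symm
    rw [← hbk] at hx0
    by_cases hxb : x ∈ Set.range b
    · obtain ⟨l, rfl⟩ := hxb
      have hl0 : l ≠ i₀ := by
        rintro rfl
        exact absurd (hbmin l (b k)) (not_le.2 hx0)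
      have hlk : l ≠ k := by
        rintro rfl
        exact lt_irrefl _ hx0
      have := hx.1 l hlk
      rw [hmi l hl0] at this
      exact lt_irrefl _ this
    · exact absurd (hb i₀ k hk0.symm x hxb) (not_lt.2 hx0.le)
  obtain ⟨x, hx⟩ : ∃ x, IsBestAbove v m i₀ x := by
    refine exists_isBestAbove (w := t) fun i hi => ?_
    rw [hmi i hi]
    exact lt_of_le_of_ne (hbmin i t) fun h => htb ⟨i, hv i h⟩
  rw [Finset.card_eq_one]
  refine ⟨insert x τ, ?_⟩
  ext S
  rw [Finset.mem_filter, mem_rooms_of_subset_iff hcard, Finset.mem_singleton]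
  simp only [hiff', hnone, or_false]
  constructor
  · rintro ⟨z, hz, rfl⟩
    rw [hz.unique hv hx]
  · rintro rfl
    exact ⟨x, hx, rfl⟩

/-- Scarf's lemma: if each ranking `i` has a lowest point `b i`, which all other rankings place
above every point outside the range of `b`, then any colouring that gives `b i` the colour `i`
admits a dominating set with points of all colours. -/
theorem exists_dominating_image_eq_univ [Nontrivial ι] (hv : ∀ i, Function.Injective (v i))
    {b : ι → P} (hbmin : ∀ i x, v i (b i) ≤ v i x)
    (hb : ∀ i j, i ≠ j → ∀ x ∉ Set.range b, v i x < v i (b j)) {t : P} (htb : t ∉ Set.range b)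
    {c : P → ι} (hc : ∀ i, c (b i) = i) :
    ∃ S, Dominating v S ∧ S.image c = Finset.univ := by
  by_contra! hcon
  obtain ⟨i₀⟩ : Nonempty ι := inferInstance
  have hbinj : Function.Injective b := Function.LeftInverse.injective hc
  set τ₀ := (Finset.univ.erase i₀).image b with hτ₀
  have hdom : Dominating v τ₀ := by
    intro x
    by_cases hx : x ∈ Set.range b
    · obtain ⟨l, rfl⟩ := hx
      exact ⟨l, fun y _ => hbmin l y⟩
    · refine ⟨i₀, fun y hy => ?_⟩
      obtain ⟨l, hl, rfl⟩ := Finset.mem_image.1 hy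
      exact (hb i₀ l (Finset.mem_erase.1 hl).1.symm x hx).le
  have hτ₀mem : τ₀ ∈ doors v c i₀ := by
    simp only [doors, Finset.mem_filter, Finset.mem_univ, true_and]
    refine ⟨hdom, ?_, ?_⟩
    · rw [hτ₀, Finset.card_image_of_injective _ hbinj,
        Finset.card_erase_add_one (Finset.mem_univ _), Finset.card_univ]
    · rw [hτ₀, Finset.image_image, show c ∘ b = id from funext hc, Finset.image_id]
  have hdouble := Finset.sum_card_bipartiteAbove_eq_sum_card_bipartiteBelow
    (s := doors v c i₀) (t := rooms v) (fun τ S => τ ⊆ S)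
  simp only [Finset.bipartiteAbove, Finset.bipartiteBelow] at hdouble
  have hright : Even (∑ S ∈ rooms v, ((doors v c i₀).filter (· ⊆ S)).card) :=
    Finset.even_sum _ fun S hS => even_card_doors_of_room hS
      (hcon S (by simp only [rooms, Finset.mem_filter] at hS; exact hS.2.1))
  rw [← hdouble, ← Finset.add_sum_erase _ _ hτ₀mem,
    card_rooms_of_boundary_door hv hbinj hbmin hb htb i₀ hdom] at hright
  have hrest : Even (∑ τ ∈ (doors v c i₀).erase τ₀, ((rooms v).filter (τ ⊆ ·)).card) := by
    refine Finset.even_sum _ fun τ hτ => ?_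
    obtain ⟨hne, hτ⟩ := Finset.mem_erase.1 hτ
    simp only [doors, Finset.mem_filter, Finset.mem_univ, true_and] at hτ
    obtain ⟨h1, h2, h3⟩ := hτ
    obtain ⟨s, hs, hsb⟩ : ∃ s ∈ τ, s ∉ Set.range b := by
      by_contra! hall
      apply hne
      ext y
      rw [hτ₀, Finset.mem_image]
      constructor
      · intro hy
        obtain ⟨l, rfl⟩ := hall y hy
        have := Finset.mem_image_of_mem c hy
        rw [h3, hc] at this
        exact ⟨l, this, rfl⟩
      · rintro ⟨l, hl, rfl⟩
        rw [← h3, Finset.mem_image] at hl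
        obtain ⟨y, hy, rfl⟩ := hl
        obtain ⟨l, rfl⟩ := hall y hy
        rwa [hc]
    exact even_card_rooms_of_door hv hb h1 h2 hs hsb
  rcases hright with ⟨r, hr⟩
  rcases hrest with ⟨s, hs⟩
  omega

end Scarf

section Simplex

variable {ι : Type*} [Fintype ι]

/-- A colouring of the simplex in which `x` may only be given a colour of the set `A x` takes all
colours within a small set, apart from colours of almost vanishing coordinates. -/
theorem exists_near_colours [Nontrivial ι] {A : (ι → ℝ) → ι → Prop}
    (hA : ∀ x ∈ stdSimplex ℝ ι, ∃ i, A x i) {δ : ℝ} (hδ : 0 < δ) :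
    ∃ z ∈ stdSimplex ℝ ι, ∀ i, z i < δ ∨ ∃ w ∈ stdSimplex ℝ ι, dist w z < δ ∧ A w i := by
  classical
  obtain ⟨n, hn⟩ : ∃ n : ℝ, n = Fintype.card ι := ⟨_, rfl⟩
  have hn0 : 0 < n := by rw [hn]; exact_mod_cast Fintype.card_pos
  set η := δ / n with hη
  have hη0 : 0 < η := div_pos hδ hn0
  have hnη : n * η = δ := mul_div_cancel₀ _ hn0.ne'
  obtain ⟨T, hTsub, hTfin, hTcover⟩ :=
    (isCompact_stdSimplex ℝ ι).finite_cover_balls hη0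
  have := hTfin.fintype
  let pos : T ⊕ ι → ι → ℝ := Sum.elim (fun x => x) fun j i => if i = j then -1 else 2
  let idx := Fintype.equivFin (T ⊕ ι)
  let v : ι → T ⊕ ι → ℝ ×ₗ Fin (Fintype.card (T ⊕ ι)) := fun i x => toLex (pos x i, idx x)
  have hv : ∀ i, Function.Injective (v i) := fun i x y hxy =>
    idx.injective (congrArg (fun p => (ofLex p).2) hxy)
  have hvlt : ∀ i x y, pos x i < pos y i → v i x < v i y := fun i x y hxy =>
    Prod.Lex.toLex_lt_toLex.2 (.inl hxy)
  have hvle : ∀ i x y, v i x ≤ v i y → pos x i ≤ pos y i := fun i x y hxy =>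
    not_lt.1 fun h => absurd (hvlt i y x h) (not_lt.2 hxy)
  have hpos : ∀ (x : T) i, 0 ≤ pos (.inl x) i ∧ pos (.inl x) i ≤ 1 := fun x i =>
    ⟨(hTsub x.2).1 i, (Finset.single_le_sum (fun j _ => (hTsub x.2).1 j)
      (Finset.mem_univ i)).trans_eq (hTsub x.2).2⟩
  have hposb : ∀ i, pos (.inr i) i = -1 := fun i => by simp [pos]
  have hposb' : ∀ i j, i ≠ j → pos (.inr j) i = 2 := fun i j h => by simp [pos, h]
  have hbmin : ∀ i x, v i (.inr i) ≤ v i x := by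
    rintro i (x | j)
    · exact (hvlt _ _ _ (by linarith [hposb i, (hpos x i).1])).le
    · by_cases h : i = j
      · rw [h]
      · exact (hvlt _ _ _ (by rw [hposb, hposb' _ _ h]; norm_num)).le
  have hb : ∀ i j, i ≠ j → ∀ x ∉ Set.range (Sum.inr : ι → T ⊕ ι), v i x < v i (.inr j) := by
    rintro i j hij (x | k) hx
    · exact hvlt _ _ _ (by linarith [hposb' i j hij, (hpos x i).2])
    · exact absurd ⟨k, rfl⟩ hx
  choose! col hcol using hA
  obtain ⟨i₀⟩ : Nonempty ι := inferInstance
  obtain ⟨t₀, ht₀, -⟩ := Set.mem_iUnion₂.1 (hTcover (single_mem_stdSimplex ℝ i₀))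
  obtain ⟨S, hS, hSc⟩ := exists_dominating_image_eq_univ hv hbmin hb
    (t := .inl ⟨t₀, ht₀⟩) (by simp) (c := Sum.elim (fun x => col x) id) (fun i => rfl)
  have hSpos : ∀ x, ∃ i, ∀ y ∈ S, pos x i ≤ pos y i := fun x => by
    obtain ⟨i, hi⟩ := hS x
    exact ⟨i, fun y hy => hvle _ _ _ (hi y hy)⟩
  obtain ⟨z, hz⟩ : ∃ z : T, .inl z ∈ S := by
    by_contra! hnone
    obtain ⟨i, hi⟩ := hSpos (.inl ⟨t₀, ht₀⟩)
    obtain ⟨y, hy, hyc⟩ := Finset.mem_image.1 (hSc ▸ Finset.mem_univ i)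
    rcases y with y | j
    · exact hnone y hy
    · obtain rfl : j = i := hyc
      linarith [hi _ hy, hposb j, (hpos ⟨t₀, ht₀⟩ j).1]
  have hmarks : ∀ i, ∃ m : ℝ, 0 ≤ m ∧ (∀ w : T, .inl w ∈ S → m ≤ (w : ι → ℝ) i) ∧
      (∀ r : ℝ, (∀ y ∈ S, r ≤ pos y i) → r ≤ m) ∧ (.inr i ∈ S → m = 0) := by
    intro i
    by_cases hi : .inr i ∈ S
    · exact ⟨0, le_rfl, fun w _ => (hpos w i).1, fun r hr => by linarith [hr _ hi, hposb i],
        fun _ => rfl⟩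
    · obtain ⟨y, hy, hmin⟩ := Finset.exists_min_image S (fun y => pos y i) ⟨_, hz⟩
      refine ⟨pos y i, ?_, fun w hw => hmin _ hw, fun r hr => hr y hy, fun h => absurd h hi⟩
      rcases y with y | j
      · exact (hpos y i).1
      · rw [hposb' i j (by rintro rfl; exact hi hy)]
        norm_num
  choose m hm0 hmle hmax hmb using hmarks
  have hsum : 1 - ∑ i, m i < δ := by
    by_contra! hle
    set s := 1 - ∑ i, m i with hs
    have hu : (fun i => m i + s / n) ∈ stdSimplex ℝ ι := by
      refine ⟨fun i => add_nonneg (hm0 i) (div_nonneg (hδ.le.trans hle) hn0.le), ?_⟩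
      rw [Finset.sum_add_distrib, Finset.sum_const, Finset.card_univ, nsmul_eq_mul, ← hn,
        mul_div_cancel₀ _ hn0.ne', hs]
      ring
    obtain ⟨t, ht, htu⟩ := Set.mem_iUnion₂.1 (hTcover hu)
    obtain ⟨i, hi⟩ := hSpos (.inl ⟨t, ht⟩)
    have h1 : t i ≤ m i := hmax i _ hi
    have h2 := (dist_le_pi_dist _ _ i).trans_lt (Metric.mem_ball.1 htu)
    rw [Real.dist_eq, abs_lt] at h2
    have h3 : η ≤ s / n := div_le_div_of_nonneg_right hle hn0.le
    linarith [h2.2]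
  have hclose : ∀ w : T, .inl w ∈ S → ∀ i, (w : ι → ℝ) i < m i + δ := by
    intro w hw i
    have h1 : (w : ι → ℝ) i - m i ≤ ∑ j, ((w : ι → ℝ) j - m j) :=
      Finset.single_le_sum (f := fun j => (w : ι → ℝ) j - m j)
        (fun j _ => sub_nonneg.2 (hmle j w hw)) (Finset.mem_univ i)
    rw [Finset.sum_sub_distrib, (hTsub w.2).2] at h1
    linarith
  refine ⟨z, hTsub z.2, fun i => ?_⟩
  obtain ⟨y, hy, hyc⟩ := Finset.mem_image.1 (hSc ▸ Finset.mem_univ i)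
  rcases y with w | j
  · refine .inr ⟨w, hTsub w.2, (dist_pi_lt_iff hδ).2 fun k => ?_, ?_⟩
    · rw [Real.dist_eq, abs_lt]
      constructor <;> linarith [hclose w hy k, hclose z hz k, hmle k w hy, hmle k z hz]
    · obtain rfl : col w = i := hyc
      exact hcol w (hTsub w.2)
  · obtain rfl : j = i := hyc
    left
    have := hclose z hz j
    rwa [hmb j hy, zero_add] at this

theorem exists_fixedPoint_of_approximate {E : Type*} [MetricSpace E] {K : Set E}
    (hK : IsCompact K) {f : E → E} (hf : ContinuousOn f K)
    (h : ∀ ε > 0, ∃ x ∈ K, dist (f x) x ≤ ε) : ∃ x ∈ K, f x = x := by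
  obtain ⟨x₁, hx₁, -⟩ := h 1 one_pos
  obtain ⟨x, hx, hmin⟩ := hK.exists_isMinOn ⟨x₁, hx₁⟩
    (continuous_dist.comp_continuousOn (hf.prodMk continuousOn_id))
  refine ⟨x, hx, ?_⟩
  by_contra hne
  have hpos : 0 < dist (f x) x := dist_pos.2 hne
  obtain ⟨y, hy, hle⟩ := h (dist (f x) x / 2) (half_pos hpos)
  have : dist (f x) x ≤ dist (f y) y := hmin hy
  linarith

/-- Brouwer's fixed point theorem for the standard simplex. -/
theorem exists_fixedPoint_stdSimplex [Nonempty ι] {f : (ι → ℝ) → ι → ℝ}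
    (hf : ContinuousOn f (stdSimplex ℝ ι))
    (hmaps : Set.MapsTo f (stdSimplex ℝ ι) (stdSimplex ℝ ι)) :
    ∃ x ∈ stdSimplex ℝ ι, f x = x := by
  classical
  rcases subsingleton_or_nontrivial ι with hι | hι
  · obtain ⟨i⟩ := ‹Nonempty ι›
    have hone : ∀ x ∈ stdSimplex ℝ ι, ∀ j, x j = 1 := fun x hx j => by
      have := Fintype.sum_subsingleton x j
      rw [← this, hx.2]
    have hx := single_mem_stdSimplex ℝ i
    exact ⟨_, hx, funext fun j => by rw [hone _ (hmaps hx), hone _ hx]⟩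
  refine exists_fixedPoint_of_approximate (isCompact_stdSimplex ℝ ι) hf fun ε hε => ?_
  have hn0 : (0 : ℝ) < Fintype.card ι := by exact_mod_cast Fintype.card_pos
  set η := ε / (2 * Fintype.card ι) with hη
  have hη0 : 0 < η := by positivity
  obtain ⟨δ, hδ, hunif⟩ := Metric.uniformContinuousOn_iff.1
    ((isCompact_stdSimplex ℝ ι).uniformContinuousOn_of_continuous hf) η hη0
  have hA : ∀ x ∈ stdSimplex ℝ ι, ∃ i, x i ≤ f x i := fun x hx => by
    by_contra! hlt
    have := Finset.sum_lt_sum_of_nonempty Finset.univ_nonempty fun i _ => hlt i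
    rw [hx.2, (hmaps hx).2] at this
    exact lt_irrefl _ this
  obtain ⟨z, hz, hnear⟩ := exists_near_colours hA (lt_min hδ hη0)
  have hlow : ∀ i, 0 ≤ f z i - z i + 2 * η := by
    intro i
    rcases hnear i with hi | ⟨w, hw, hwz, hi⟩
    · linarith [(hmaps hz).1 i, min_le_right δ η]
    · have h1 := (dist_le_pi_dist _ _ i).trans_lt
        (hunif w hw z hz (hwz.trans_le (min_le_left _ _)))
      have h2 := (dist_le_pi_dist _ _ i).trans_lt (hwz.trans_le (min_le_right _ _))
      rw [Real.dist_eq, abs_lt] at h1 h2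
      linarith [h1.2, h2.1]
  refine ⟨z, hz, (dist_pi_le_iff hε.le).2 fun i => ?_⟩
  have hup : f z i - z i + 2 * η ≤ ∑ j, (f z j - z j + 2 * η) :=
    Finset.single_le_sum (f := fun j => f z j - z j + 2 * η) (fun j _ => hlow j)
      (Finset.mem_univ i)
  have hsum : ∑ j, (f z j - z j + 2 * η) = ε := by
    rw [Finset.sum_add_distrib, Finset.sum_sub_distrib, (hmaps hz).2, hz.2, Finset.sum_const,
      Finset.card_univ, nsmul_eq_mul, hη]
    field_simp
    ring
  have hηε : 2 * η ≤ ε := by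
    have h1 : (1 : ℝ) ≤ Fintype.card ι := by exact_mod_cast Fintype.card_pos
    have : 2 * η = ε / Fintype.card ι := by rw [hη]; field_simp
    rw [this]
    exact div_le_self hε.le h1
  rw [Real.dist_eq, abs_le]
  constructor <;> linarith [hlow i]

end Simplex

/-- Schauder's projection: a compact set is mapped, with small displacement, into the convex hull of
finitely many of its points by means of continuous barycentric weights. -/
theorem exists_barycentric_approximation {E : Type*} [NormedAddCommGroup E] [NormedSpace ℝ E]
    {K : Set E} (hK : IsCompact K) {ε : ℝ} (hε : 0 < ε) :
    ∃ t : Finset E, ↑t ⊆ K ∧ ∃ p : E → t → ℝ, ContinuousOn p K ∧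
      ∀ x ∈ K, p x ∈ stdSimplex ℝ t ∧ dist (∑ y, p x y • (y : E)) x ≤ ε := by
  obtain ⟨T, hTsub, hTfin, hTcover⟩ := hK.finite_cover_balls hε
  obtain ⟨t, rfl⟩ := hTfin.exists_finset_coe
  let g : E → t → ℝ := fun x y => max 0 (ε - dist x y)
  have hg0 : ∀ x y, 0 ≤ g x y := fun x y => le_max_left _ _
  have hgc : ∀ y, Continuous fun x => g x y := fun y => by fun_prop
  have hpos : ∀ x ∈ K, 0 < ∑ y, g x y := fun x hx => by
    obtain ⟨y, hy, hxy⟩ := Set.mem_iUnion₂.1 (hTcover hx)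
    exact Finset.sum_pos' (fun y _ => hg0 x y)
      ⟨⟨y, hy⟩, Finset.mem_univ _, lt_max_of_lt_right (sub_pos.2 hxy)⟩
  have hmem : ∀ x ∈ K, (fun y => g x y / ∑ y, g x y) ∈ stdSimplex ℝ t := fun x hx =>
    ⟨fun y => div_nonneg (hg0 x y) (hpos x hx).le, by
      rw [← Finset.sum_div, div_self (hpos x hx).ne']⟩
  refine ⟨t, hTsub, fun x y => g x y / ∑ y, g x y, ?_, fun x hx => ⟨hmem x hx, ?_⟩⟩
  · exact continuousOn_pi.2 fun y => (hgc y).continuousOn.div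
      (continuous_finsetSum _ fun y _ => hgc y).continuousOn fun x hx => (hpos x hx).ne'
  · set q : t → ℝ := fun y => g x y / ∑ y, g x y with hq
    have hq1 : ∑ y, q y = 1 := (hmem x hx).2
    have hdiff : ∑ y, q y • (y : E) - x = ∑ y, q y • ((y : E) - x) := by
      simp_rw [smul_sub]
      rw [Finset.sum_sub_distrib, ← Finset.sum_smul, hq1, one_smul]
    rw [dist_eq_norm, hdiff]
    calc ‖∑ y, q y • ((y : E) - x)‖ ≤ ∑ y, ‖q y • ((y : E) - x)‖ := norm_sum_le _ _
      _ ≤ ∑ y, q y * ε := by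
          refine Finset.sum_le_sum fun y _ => ?_
          have hqy : 0 ≤ q y := (hmem x hx).1 y
          rw [norm_smul, Real.norm_of_nonneg hqy]
          by_cases hy : dist x y ≤ ε
          · exact mul_le_mul_of_nonneg_left (by rwa [← dist_eq_norm, dist_comm]) hqy
          · have : q y = 0 := by
              simp only [hq, g, max_eq_left (sub_nonpos.2 (not_le.1 hy).le), zero_div]
            rw [this, zero_mul, zero_mul]
      _ = ε := by rw [← Finset.sum_mul, hq1, one_mul]

/-- Schauder's fixed point theorem for compact convex sets. -/
theorem exists_fixedPoint_of_isCompact_of_convex {E : Type*} [NormedAddCommGroup E]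
    [NormedSpace ℝ E] {K : Set E} (hKne : K.Nonempty) (hK : IsCompact K) (hconv : Convex ℝ K)
    {f : E → E} (hf : ContinuousOn f K) (hmaps : Set.MapsTo f K K) : ∃ x ∈ K, f x = x := by
  refine exists_fixedPoint_of_approximate hK hf fun ε hε => ?_
  obtain ⟨t, htK, p, hpc, hp⟩ := exists_barycentric_approximation hK hε
  let g : (t → ℝ) → E := fun q => ∑ y, q y • (y : E)
  have hg : Set.MapsTo g (stdSimplex ℝ t) K := fun q hq =>
    hconv.sum_mem (fun y _ => hq.1 y) hq.2 fun y _ => htK y.2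
  have hgc : Continuous g := by fun_prop
  have : Nonempty t := by
    obtain ⟨x, hx⟩ := hKne
    by_contra hempty
    rw [not_nonempty_iff] at hempty
    simpa using (hp x hx).1.2
  obtain ⟨q, hq, hfix⟩ := exists_fixedPoint_stdSimplex (f := p ∘ f ∘ g)
    (hpc.comp (hf.comp hgc.continuousOn hg) (hmaps.comp hg))
    (fun q hq => (hp _ (hmaps (hg hq))).1)
  refine ⟨g q, hg hq, ?_⟩
  have h := (hp _ (hmaps (hg hq))).2
  rw [dist_comm]
  convert h using 2
  exact congrArg g hfix.symm


/-- Browder fixed point theorem (as obtained from the pseudo-continuous minimax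
inequality): a continuous self-map of a nonempty compact convex subset of `ℝⁿ`
has a fixed point. -/
theorem browder_fixed_point
    {n : ℕ} (X : Set (EuclideanSpace ℝ (Fin n)))
    (hXne : X.Nonempty) (hXc : IsCompact X) (hXconv : Convex ℝ X)
    (h : EuclideanSpace ℝ (Fin n) → EuclideanSpace ℝ (Fin n))
    (hc : ContinuousOn h X) (hmaps : Set.MapsTo h X X) :
    ∃ x₀ ∈ X, h x₀ = x₀ := by
  exact exists_fixedPoint_of_isCompact_of_convex hXne hXc hXconv hc hmaps
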